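/- Let A₁,A₂,A₃,B₁,B₂,B₃,C ∈ ℝ² satisfy condition (⋆). Then there exist i₀, j₀ ∈ {1,2,3} such that all six vectors A₁,A₂,A₃,B₁,B₂,B₃ belong to cone(A_{i₀}, B_{j₀}); consequently cone(A_{i₀}, B_{j₀}) = cone(A₁,A₂,A₃,B₁,B₂,B₃). -/

import Mathlib

open scoped BigOperators

/-- The cone spanned by two vectors in `ℝ²`. -/
def cone2 (u v : ℝ × ℝ) : Set (ℝ × ℝ) :=
  {x | ∃ a b : ℝ, 0 ≤ a ∧ 0 ≤ b ∧ x = a • u + b • v}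

/-- The cone spanned by a finite family of vectors in `ℝ²`. -/
def coneFam {n : ℕ} (s : Fin n → ℝ × ℝ) : Set (ℝ × ℝ) :=
  {x | ∃ lam : Fin n → ℝ, (∀ i, 0 ≤ lam i) ∧ x = ∑ i, lam i • s i}

/-- Condition (⋆). -/
def starCond (A B : Fin 3 → ℝ × ℝ) (C : ℝ × ℝ) : Prop :=
  (∀ i j : Fin 3, C ∉ cone2 (A i) (A j)) ∧
  (∀ i j : Fin 3, C ∉ cone2 (B i) (B j)) ∧
  (∀ i j : Fin 3, C ∈ cone2 (A i) (B j))

lemma cone2_add_mem {u v x y : ℝ × ℝ} (hx : x ∈ cone2 u v) (hy : y ∈ cone2 u v) :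
    x + y ∈ cone2 u v := by
  obtain ⟨a, b, ha, hb, rfl⟩ := hx
  obtain ⟨c, d, hc, hd, rfl⟩ := hy
  exact ⟨a + c, b + d, by positivity, by positivity, by module⟩

lemma cone2_smul_mem {u v x : ℝ × ℝ} {r : ℝ} (hr : 0 ≤ r) (hx : x ∈ cone2 u v) :
    r • x ∈ cone2 u v := by
  obtain ⟨a, b, ha, hb, rfl⟩ := hx
  exact ⟨r * a, r * b, by positivity, by positivity, by module⟩

lemma left_mem_cone2 (u v : ℝ × ℝ) : u ∈ cone2 u v :=
  ⟨1, 0, zero_le_one, le_rfl, by simp⟩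

lemma right_mem_cone2 (u v : ℝ × ℝ) : v ∈ cone2 u v :=
  ⟨0, 1, le_rfl, zero_le_one, by simp⟩

lemma cone2_subset_cone2 {u v x y : ℝ × ℝ} (hx : x ∈ cone2 u v) (hy : y ∈ cone2 u v) :
    cone2 x y ⊆ cone2 u v := by
  rintro _ ⟨a, b, ha, hb, rfl⟩
  exact cone2_add_mem (cone2_smul_mem ha hx) (cone2_smul_mem hb hy)

lemma coneFam_subset_cone2 {n : ℕ} {s : Fin n → ℝ × ℝ} {u v : ℝ × ℝ}
    (h : ∀ i, s i ∈ cone2 u v) : coneFam s ⊆ cone2 u v := by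
  rintro _ ⟨l, hl, rfl⟩
  exact Finset.sum_induction _ (· ∈ cone2 u v) (fun _ _ ↦ cone2_add_mem)
    ⟨0, 0, le_rfl, le_rfl, by simp⟩ fun i _ ↦ cone2_smul_mem (hl i) (h i)

lemma cone2_subset_coneFam {n : ℕ} (s : Fin n → ℝ × ℝ) (i j : Fin n) :
    cone2 (s i) (s j) ⊆ coneFam s := by
  rintro _ ⟨a, b, ha, hb, rfl⟩
  refine ⟨fun k ↦ (if k = i then a else 0) + (if k = j then b else 0), fun k ↦ ?_, ?_⟩
  · dsimp only
    split_ifs <;> positivity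
  · simp [add_smul, Finset.sum_add_distrib, ite_smul]

/-- The determinant of two vectors of the plane. -/
def planeDet (u v : ℝ × ℝ) : ℝ := u.1 * v.2 - u.2 * v.1

lemma sq_add_sq_pos_of_ne_zero {c : ℝ × ℝ} (hc : c ≠ 0) : 0 < c.1 ^ 2 + c.2 ^ 2 := by
  by_contra! h
  exact hc (Prod.ext (by simp; nlinarith [sq_nonneg c.1, sq_nonneg c.2])
    (by simp; nlinarith [sq_nonneg c.1, sq_nonneg c.2]))

lemma eq_smul_of_planeDet_eq_zero {u c : ℝ × ℝ} (hc : c ≠ 0) (h : planeDet u c = 0) :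
    u = ((u.1 * c.1 + u.2 * c.2) / (c.1 ^ 2 + c.2 ^ 2)) • c := by
  have hpos := (sq_add_sq_pos_of_ne_zero hc).ne'
  unfold planeDet at h
  ext
  · simp only [Prod.smul_fst, smul_eq_mul]
    field_simp
    linear_combination c.2 * h
  · simp only [Prod.smul_snd, smul_eq_mul]
    field_simp
    linear_combination -c.1 * h

/-- Among finitely many vectors strictly on one side of the line through `c`, some vector `V i₀`
is such that every other one lies in the cone spanned by `V i₀` and `c`. -/
lemma exists_forall_mem_cone2 {ι : Type*} [Finite ι] [Nonempty ι] {V : ι → ℝ × ℝ} {c : ℝ × ℝ}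
    {r : ℝ} (hc : c ≠ 0) (h : ∀ i, 0 < r * planeDet (V i) c) :
    ∃ i₀, ∀ k, V k ∈ cone2 (V i₀) c := by
  obtain ⟨i, hi⟩ := Finite.exists_min
    fun i ↦ ((V i).1 * c.1 + (V i).2 * c.2) / (r * planeDet (V i) c)
  refine ⟨i, fun k ↦ ?_⟩
  have hik := hi k
  have h1 := h i
  have h2 := h k
  set s := (r * planeDet (V k) c) / (r * planeDet (V i) c) with hs
  have hs0 : 0 < s := div_pos h2 h1
  have hsd : planeDet (V k) c = s * planeDet (V i) c := by
    have hr : r ≠ 0 := left_ne_zero_of_mul h1.ne'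
    have hd : planeDet (V i) c ≠ 0 := right_ne_zero_of_mul h1.ne'
    rw [hs]
    field_simp
  have hdet : planeDet (V k - s • V i) c = 0 := by
    simp only [planeDet, Prod.fst_sub, Prod.snd_sub, Prod.smul_fst, Prod.smul_snd,
      smul_eq_mul] at hsd ⊢
    linear_combination hsd
  have hge : s * ((V i).1 * c.1 + (V i).2 * c.2) ≤ (V k).1 * c.1 + (V k).2 * c.2 := by
    rw [le_div_iff₀ h2] at hik
    refine le_of_eq_of_le ?_ hik
    rw [hs]
    ring
  refine ⟨s, _, hs0.le, ?_, sub_eq_iff_eq_add'.1 (eq_smul_of_planeDet_eq_zero hc hdet)⟩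
  refine div_nonneg ?_ (sq_add_sq_pos_of_ne_zero hc).le
  simp only [Prod.fst_sub, Prod.snd_sub, Prod.smul_fst, Prod.smul_snd, smul_eq_mul]
  linarith

lemma smul_coeff_nonpos {u c : ℝ × ℝ} {p : ℝ} (hu : u = p • c) (h : c ∉ cone2 u u) : p ≤ 0 := by
  by_contra! hp
  refine h ⟨p⁻¹, 0, by positivity, le_rfl, ?_⟩
  rw [hu, smul_smul, inv_mul_cancel₀ hp.ne']
  simp

/-- A vector in `cone(u, v)`, but on neither of the two rays, strictly separates `u` from `v`. -/
lemma planeDet_mul_planeDet_pos {u v c : ℝ × ℝ} (hu : c ∉ cone2 u u) (hv : c ∉ cone2 v v)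
    (h : c ∈ cone2 u v) : 0 < planeDet u c * planeDet c v := by
  have hc : c ≠ 0 := by
    rintro rfl
    exact hu ⟨0, 0, le_rfl, le_rfl, by simp⟩
  obtain ⟨a, b, ha, hb, hab⟩ := h
  have ha' : 0 < a := ha.lt_of_ne (by
    rintro rfl
    exact hv ⟨b, 0, hb, le_rfl, by simpa using hab⟩)
  have hb' : 0 < b := hb.lt_of_ne (by
    rintro rfl
    exact hu ⟨a, 0, ha, le_rfl, by simpa using hab⟩)
  have huc : planeDet u c = b * planeDet u v := by
    simp only [hab, planeDet, Prod.fst_add, Prod.snd_add, Prod.smul_fst, Prod.smul_snd,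
      smul_eq_mul]
    ring
  have hcv : planeDet c v = a * planeDet u v := by
    simp only [hab, planeDet, Prod.fst_add, Prod.snd_add, Prod.smul_fst, Prod.smul_snd,
      smul_eq_mul]
    ring
  have hne : planeDet u v ≠ 0 := by
    intro h0
    have hvc : planeDet v c = 0 := by
      rw [h0, mul_zero] at hcv
      unfold planeDet at hcv ⊢
      linarith
    have hup := eq_smul_of_planeDet_eq_zero hc (by rw [huc, h0, mul_zero])
    have hvq := eq_smul_of_planeDet_eq_zero hc hvc
    have hp := smul_coeff_nonpos hup hu
    have hq := smul_coeff_nonpos hvq hv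
    generalize (u.1 * c.1 + u.2 * c.2) / (c.1 ^ 2 + c.2 ^ 2) = p at hup hp
    generalize (v.1 * c.1 + v.2 * c.2) / (c.1 ^ 2 + c.2 ^ 2) = q at hvq hq
    have hzero : (1 - a * p - b * q) • c = 0 := by
      rw [hup, hvq] at hab
      rw [sub_smul, sub_smul, one_smul, mul_smul, mul_smul, sub_sub, ← hab, sub_self]
    rcases smul_eq_zero.1 hzero with h1 | h1
    · nlinarith
    · exact hc h1
  rw [huc, hcv]
  have := sq_pos_of_ne_zero hne
  nlinarith [mul_pos (mul_pos ha' hb') this]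

theorem stmt8 (A B : Fin 3 → ℝ × ℝ) (C : ℝ × ℝ) (hstar : starCond A B C) :
    ∃ i₀ j₀ : Fin 3,
      (∀ k : Fin 3, A k ∈ cone2 (A i₀) (B j₀) ∧ B k ∈ cone2 (A i₀) (B j₀)) ∧
      cone2 (A i₀) (B j₀) = coneFam ![A 0, A 1, A 2, B 0, B 1, B 2] := by
  obtain ⟨hA, hB, hAB⟩ := hstar
  have hC : C ≠ 0 := by
    rintro rfl
    exact hA 0 0 ⟨0, 0, le_rfl, le_rfl, by simp⟩
  have hpos (i j : Fin 3) : 0 < planeDet (A i) C * planeDet C (B j) :=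
    planeDet_mul_planeDet_pos (hA i i) (hB j j) (hAB i j)
  obtain ⟨i₀, hi₀⟩ := exists_forall_mem_cone2 (V := A) (r := planeDet C (B 0)) hC
    fun i ↦ by rw [mul_comm]; exact hpos i 0
  obtain ⟨j₀, hj₀⟩ := exists_forall_mem_cone2 (V := B) (r := -planeDet (A 0) C) hC
    fun j ↦ by
      have h := hpos 0 j
      unfold planeDet at h ⊢
      linarith
  have hAmem (k : Fin 3) : A k ∈ cone2 (A i₀) (B j₀) :=
    cone2_subset_cone2 (left_mem_cone2 _ _) (hAB i₀ j₀) (hi₀ k)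
  have hBmem (k : Fin 3) : B k ∈ cone2 (A i₀) (B j₀) :=
    cone2_subset_cone2 (right_mem_cone2 _ _) (hAB i₀ j₀) (hj₀ k)
  refine ⟨i₀, j₀, fun k ↦ ⟨hAmem k, hBmem k⟩, Set.Subset.antisymm ?_ ?_⟩
  · have hAi : ![A 0, A 1, A 2, B 0, B 1, B 2] (Fin.castAdd 3 i₀) = A i₀ := by
      fin_cases i₀ <;> rfl
    have hBj : ![A 0, A 1, A 2, B 0, B 1, B 2] (Fin.natAdd 3 j₀) = B j₀ := by
      fin_cases j₀ <;> rfl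
    have h := cone2_subset_coneFam ![A 0, A 1, A 2, B 0, B 1, B 2]
      (Fin.castAdd 3 i₀) (Fin.natAdd 3 j₀)
    rwa [hAi, hBj] at h
  · refine coneFam_subset_cone2 fun k ↦ ?_
    fin_cases k
    exacts [hAmem 0, hAmem 1, hAmem 2, hBmem 0, hBmem 1, hBmem 2]
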